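/- The group ⟨φ, Aff_3(k)⟩ is the amalgamated free product of Aff_3(k) and ⟨φ, B⟩ over their intersection B. In particular: Aff_3(k) and ⟨φ, B⟩ generate ⟨φ, Aff_3(k)⟩, Aff_3(k) ∩ ⟨φ, B⟩ = B, and for any s ≥ 1, any α_1,...,α_s ∈ Aff_3(k) \ B and any ρ_1,...,ρ_s ∈ ⟨φ, B⟩ \ B, the composition α_1 ∘ ρ_1 ∘ ··· ∘ α_s ∘ ρ_s is not an affine automorphism (hence not the identity). -/

import Mathlib

open MvPolynomial

noncomputable section

namespace YasudaPaper

variable {k : Type*} [Field k]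

/-- `f := x1*x3 - x2^2` (variables: `X 0 = x1, X 1 = x2, X 2 = x3`). -/
def fP : MvPolynomial (Fin 3) k := X 0 * X 2 - X 1 ^ 2

/-- `r := x2*f + x1^2`. -/
def rP : MvPolynomial (Fin 3) k := X 1 * fP + X 0 ^ 2

/-- `g := x3*f^2 + 2*x1*x2*f + x1^3`. -/
def gP : MvPolynomial (Fin 3) k := X 2 * fP ^ 2 + 2 * X 0 * X 1 * fP + X 0 ^ 3

/-- The Jacobian derivation `Δ = Δ_{(f,g)}`, `h ↦ det ∂(f,g,h)/∂(x1,x2,x3)`. -/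
def Del (h : MvPolynomial (Fin 3) k) : MvPolynomial (Fin 3) k :=
  Matrix.det !![pderiv 0 fP, pderiv 1 fP, pderiv 2 fP;
                pderiv 0 gP, pderiv 1 gP, pderiv 2 gP;
                pderiv 0 h,  pderiv 1 h,  pderiv 2 h]

/-- `φ = exp D`: for every `h` and every `N` with `D^[N] h = 0`,
    `φ h = ∑_{i<N} D^i(h)/i!`.  (For a locally nilpotent `D` this characterizes
    the exponential automorphism.) -/
def IsExpOf {σ : Type*} (D : MvPolynomial σ k → MvPolynomial σ k)
    (φ : MvPolynomial σ k ≃ₐ[k] MvPolynomial σ k) : Prop :=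
  ∀ (h : MvPolynomial σ k) (N : ℕ), D^[N] h = 0 →
    φ h = ∑ i ∈ Finset.range N, (Nat.factorial i : k)⁻¹ • D^[i] h

/-- `α` is an affine automorphism: `α(x_i) = ∑_j a_{j,i} x_j + b_i` with `A ∈ GL₃(k)`. -/
def IsAffine (α : MvPolynomial (Fin 3) k ≃ₐ[k] MvPolynomial (Fin 3) k) : Prop :=
  ∃ (A : Matrix (Fin 3) (Fin 3) k) (b : Fin 3 → k), IsUnit A.det ∧
    ∀ i : Fin 3, α (X i) = (∑ j : Fin 3, C (A j i) * X j) + C (b i)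

/-- `Aff_3(k)` as a set of automorphisms. -/
def AffSet : Set (MvPolynomial (Fin 3) k ≃ₐ[k] MvPolynomial (Fin 3) k) := {α | IsAffine α}

/-- `α` is a triangular automorphism: `α(x_i) = a_i x_i + f_i(x_1,…,x_{i-1})`, `a_i ≠ 0`. -/
def IsTriangular (α : MvPolynomial (Fin 3) k ≃ₐ[k] MvPolynomial (Fin 3) k) : Prop :=
  ∃ (a : Fin 3 → k) (p : Fin 3 → MvPolynomial (Fin 3) k),
    (∀ i, a i ≠ 0) ∧ (∀ i, p i ∈ MvPolynomial.supported k {j | j < i}) ∧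
    (∀ i, α (X i) = C (a i) * X i + p i)

/-- `BA_3(k)` as a set of automorphisms. -/
def TriSet : Set (MvPolynomial (Fin 3) k ≃ₐ[k] MvPolynomial (Fin 3) k) := {α | IsTriangular α}

/-- The tame subgroup `TA_3(k) = ⟨Aff_3(k), BA_3(k)⟩`. -/
def TA : Subgroup (MvPolynomial (Fin 3) k ≃ₐ[k] MvPolynomial (Fin 3) k) :=
  Subgroup.closure (AffSet ∪ TriSet)

/-- `β = β_u = (u^3 x1, u^2 x2, u x3)`. -/
def IsBeta (u : k) (β : MvPolynomial (Fin 3) k ≃ₐ[k] MvPolynomial (Fin 3) k) : Prop :=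
  β (X 0) = C (u ^ 3) * X 0 ∧ β (X 1) = C (u ^ 2) * X 1 ∧ β (X 2) = C u * X 2

/-- `B = {β_u | u ∈ k^*}`. -/
def BSet : Set (MvPolynomial (Fin 3) k ≃ₐ[k] MvPolynomial (Fin 3) k) :=
  {β | ∃ u : k, u ≠ 0 ∧ IsBeta u β}

/-! Six-variable ring `k[x1,x2,x3,t_r,t_f,t_g]`:
variables `X 0 = x1, X 1 = x2, X 2 = x3, X 3 = t_r, X 4 = t_f, X 5 = t_g`. -/

/-- The inclusion of variable index sets. -/
def ι36 : Fin 3 → Fin 6 := Fin.castLE (by norm_num)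

/-- The embedding `k[x1,x2,x3] → k[x1,x2,x3,t_r,t_f,t_g]`. -/
def embP : MvPolynomial (Fin 3) k →ₐ[k] MvPolynomial (Fin 6) k := rename ι36

/-- The substitution map `π : t_r ↦ r, t_f ↦ f, t_g ↦ g` (fixing `x1,x2,x3`). -/
def piMap : MvPolynomial (Fin 6) k →ₐ[k] MvPolynomial (Fin 3) k :=
  aeval ![X 0, X 1, X 2, rP, fP, gP]

/-- The triangular derivation
`Δ' = -2 t_r t_f ∂/∂x1 + (4 x1 t_r - t_g) ∂/∂x2 + (6 x2 t_r + 2 t_f²) ∂/∂x3 - t_f t_g ∂/∂t_r`. -/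
def Del' (p : MvPolynomial (Fin 6) k) : MvPolynomial (Fin 6) k :=
  (-(2 * X 3 * X 4)) * pderiv 0 p + (4 * X 0 * X 3 - X 5) * pderiv 1 p +
  (6 * X 1 * X 3 + 2 * X 4 ^ 2) * pderiv 2 p + (-(X 4 * X 5)) * pderiv 3 p

/-- The weight `w1 = (1,2,3,1,0,1)`. -/
def w1 : Fin 6 → ℕ := ![1, 2, 3, 1, 0, 1]

/-- The weight `w2 = (0,0,0,0,1,0)`. -/
def w2 : Fin 6 → ℕ := ![0, 0, 0, 0, 1, 0]

/-- The sixth cyclic lexicographic order on exponent vectors: first compare the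
exponent of `t_g`, then lexicographically the exponents of `x1,x2,x3,t_r,t_f`. -/
def cyclicLt (a b : Fin 6 →₀ ℕ) : Prop :=
  a 5 < b 5 ∨ (a 5 = b 5 ∧ ∃ m : Fin 5,
    (∀ l : Fin 5, l < m → a l.castSucc = b l.castSucc) ∧ a m.castSucc < b m.castSucc)

/-- The leading monomial of `p` (for the sixth cyclic lexicographic order) is `m`. -/
def LeadMonIs (p : MvPolynomial (Fin 6) k) (m : Fin 6 →₀ ℕ) : Prop :=
  m ∈ p.support ∧ ∀ m' ∈ p.support, m' ≠ m → cyclicLt m' m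

/-- The exponent vector of the monomial `t_f^δ t_g^γ`. -/
def tfMon (γ δ : ℕ) : Fin 6 →₀ ℕ := Finsupp.single 4 δ + Finsupp.single 5 γ

/-- The set `P_{γ,δ}`. -/
def Pset (γ δ : ℕ) : Set (MvPolynomial (Fin 6) k) :=
  {p | p ≠ 0 ∧ weightedTotalDegree w1 p ≤ γ ∧ weightedTotalDegree w2 p ≤ δ ∧
    LeadMonIs p (tfMon γ δ)}

/-- `α'` is a lift of `α`. -/
def IsLift (α : MvPolynomial (Fin 3) k ≃ₐ[k] MvPolynomial (Fin 3) k)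
    (α' : MvPolynomial (Fin 6) k →ₐ[k] MvPolynomial (Fin 6) k) : Prop :=
  (∀ i : Fin 3, α' (X (ι36 i)) = embP (α (X i))) ∧
  (∀ p, piMap (α' p) = α (piMap p))

/-- `t = γ_j = max {i | a_{i,j} ≠ 0}` (with rows indexed `1,2,3`). -/
def TypeIs (A : Matrix (Fin 3) (Fin 3) k) (j : Fin 3) (t : ℕ) : Prop :=
  ∃ i : Fin 3, t = (i : ℕ) + 1 ∧ A i j ≠ 0 ∧ ∀ i' : Fin 3, i < i' → A i' j = 0

/-- Condition (C) for a lift `α'` of an affine automorphism of type `(γ1,γ2,γ3)`,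
relative to `φ' = exp(uΔ')`. -/
def CondC (γ1 γ2 γ3 : ℕ) (φ' : MvPolynomial (Fin 6) k ≃ₐ[k] MvPolynomial (Fin 6) k)
    (α' : MvPolynomial (Fin 6) k →ₐ[k] MvPolynomial (Fin 6) k) : Prop :=
  ∃ m4 m5 m6 n4 n5 n6 : ℕ,
    1 ≤ n4 ∧ 1 ≤ n5 ∧ 1 ≤ n6 ∧
    φ' (α' (X 3)) ∈ Pset m4 n4 ∧
    φ' (α' (X 4)) ∈ Pset m5 n5 ∧
    φ' (α' (X 5)) ∈ Pset m6 n6 ∧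
    γ1 ≤ m6 ∧ γ2 ≤ 2 * m6 ∧ γ3 ≤ 3 * m6 ∧ m4 ≤ m6 ∧
    γ1 + 1 ≤ n6 - 1 ∧ γ2 + 1 ≤ 2 * (n6 - 1) ∧ γ3 + 1 ≤ 3 * (n6 - 1) ∧ n4 ≤ n6 - 1

/-- The image of `x_j` under the affine map given by `(A, d)`, inside the six-variable ring. -/
def affImg (A : Matrix (Fin 3) (Fin 3) k) (d : Fin 3 → k) (j : Fin 3) :
    MvPolynomial (Fin 6) k :=
  (∑ i : Fin 3, C (A i j) * X (ι36 i)) + C (d j)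

/-- The image of `t_f` under the lift `α̂`:
`α̂(t_f) = α(f) + (a_{1,1}a_{3,3} - 2a_{1,2}a_{3,2} + a_{1,3}a_{3,1})(t_f - f)`. -/
def hatTf (A : Matrix (Fin 3) (Fin 3) k) (d : Fin 3 → k) : MvPolynomial (Fin 6) k :=
  (affImg A d 0 * affImg A d 2 - affImg A d 1 ^ 2) +
    C (A 0 0 * A 2 2 - 2 * (A 0 1 * A 2 1) + A 0 2 * A 2 0) *
      (X 4 - (X 0 * X 2 - X 1 ^ 2))

/-- The lift `α̂` of the affine automorphism given by `(A, d)`: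
`α̂(x_i) = α(x_i)`, `α̂(t_f)` as in `hatTf`, `α̂(t_r) = α̂(x2 t_f + x1²)`,
`α̂(t_g) = α̂(x3 t_f² + 2 x1 x2 t_f + x1³)`. -/
def hatLift (A : Matrix (Fin 3) (Fin 3) k) (d : Fin 3 → k) :
    MvPolynomial (Fin 6) k →ₐ[k] MvPolynomial (Fin 6) k :=
  aeval ![affImg A d 0, affImg A d 1, affImg A d 2,
    affImg A d 1 * hatTf A d + affImg A d 0 ^ 2,
    hatTf A d,
    affImg A d 2 * hatTf A d ^ 2 + 2 * affImg A d 0 * affImg A d 1 * hatTf A d +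
      affImg A d 0 ^ 3]

/-! ### Degrees of points with univariate polynomial coordinates -/

section Curves

variable {x₁ x₂ x₃ : Polynomial k}

/-- The value of `f` at a point. -/
def fVal (x₁ x₂ x₃ : Polynomial k) : Polynomial k := x₁ * x₃ - x₂ ^ 2

/-- The value of `r` at a point. -/
def rVal (x₁ x₂ x₃ : Polynomial k) : Polynomial k := x₂ * fVal x₁ x₂ x₃ + x₁ ^ 2

/-- The value of `g` at a point. -/
def gVal (x₁ x₂ x₃ : Polynomial k) : Polynomial k :=
  x₃ * fVal x₁ x₂ x₃ ^ 2 + 2 * x₁ * x₂ * fVal x₁ x₂ x₃ + x₁ ^ 3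

/-- Degree conditions under which `exp(uΔ)`, `u ≠ 0`, sends a point to an `Attracting` one. -/
structure Expanding (x₁ x₂ x₃ : Polynomial k) : Prop where
  f_pos : 1 ≤ (fVal x₁ x₂ x₃).natDegree
  g_pos : 1 ≤ (gVal x₁ x₂ x₃).natDegree
  r_lt : (rVal x₁ x₂ x₃).natDegree < (fVal x₁ x₂ x₃).natDegree + (gVal x₁ x₂ x₃).natDegree
  x₁_lt : x₁.natDegree < 2 * (fVal x₁ x₂ x₃).natDegree + (gVal x₁ x₂ x₃).natDegree

/-- The degree pattern of the points in the image of an `Expanding` point under `exp(uΔ)`. -/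
structure Attracting (E D : ℕ) (x₁ x₂ x₃ : Polynomial k) : Prop where
  pos : 1 ≤ E
  lt : E < D
  f : (fVal x₁ x₂ x₃).natDegree = E
  r : (rVal x₁ x₂ x₃).natDegree = D
  x₁ : x₁.natDegree = E + D
  x₂ : x₂.natDegree = E + 2 * D
  x₃ : x₃.natDegree = E + 3 * D

lemma natDegree_C_mul_add_eq {c : k} (hc : c ≠ 0) {m q : Polynomial k}
    (h : q.natDegree < m.natDegree) : (Polynomial.C c * m + q).natDegree = m.natDegree := by
  have hm : (Polynomial.C c * m).natDegree = m.natDegree := Polynomial.natDegree_C_mul hc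
  rw [Polynomial.natDegree_add_eq_left_of_natDegree_lt (by rwa [hm]), hm]

lemma natDegree_C_mul_add_le (c : k) {m q : Polynomial k} {n : ℕ} (hm : m.natDegree ≤ n)
    (hq : q.natDegree ≤ n) : (Polynomial.C c * m + q).natDegree ≤ n :=
  Polynomial.natDegree_add_le_of_degree_le ((Polynomial.natDegree_C_mul_le _ _).trans hm) hq

lemma ne_zero_of_natDegree_pos {p : Polynomial k} (h : 1 ≤ p.natDegree) : p ≠ 0 := by
  rintro rfl
  simp at h

lemma x₁_mul_gVal (x₁ x₂ x₃ : Polynomial k) :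
    x₁ * gVal x₁ x₂ x₃ = rVal x₁ x₂ x₃ ^ 2 + fVal x₁ x₂ x₃ ^ 3 := by
  simp only [gVal, rVal, fVal]
  ring

lemma natDegree_rVal_le (x₁ x₂ x₃ : Polynomial k) :
    (rVal x₁ x₂ x₃).natDegree ≤
      max (x₂.natDegree + (fVal x₁ x₂ x₃).natDegree) (2 * x₁.natDegree) :=
  (Polynomial.natDegree_add_le _ _).trans
    (max_le_max Polynomial.natDegree_mul_le Polynomial.natDegree_pow_le)

lemma natDegree_two_mul_mul_mul_le (p q s : Polynomial k) :
    (2 * p * q * s).natDegree ≤ p.natDegree + q.natDegree + s.natDegree := by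
  have h2 : (2 * p).natDegree ≤ p.natDegree := by
    have := Polynomial.natDegree_C_mul_le (2 : k) p
    rwa [Polynomial.C_ofNat] at this
  refine Polynomial.natDegree_mul_le_of_le (Polynomial.natDegree_mul_le_of_le h2 le_rfl) le_rfl

/-- The case where `x₃ f²` is the dominant term of `g`. -/
lemma Expanding.of_x₃_dominant (h₃ : 1 ≤ x₃.natDegree) (hF : 1 ≤ (fVal x₁ x₂ x₃).natDegree)
    (h : x₁.natDegree + x₂.natDegree < x₃.natDegree + (fVal x₁ x₂ x₃).natDegree)
    (h' : 3 * x₁.natDegree < x₃.natDegree + 2 * (fVal x₁ x₂ x₃).natDegree) :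
    Expanding x₁ x₂ x₃ := by
  have hR := natDegree_rVal_le x₁ x₂ x₃
  have hG : (gVal x₁ x₂ x₃).natDegree = x₃.natDegree + 2 * (fVal x₁ x₂ x₃).natDegree := by
    have hm : (x₃ * fVal x₁ x₂ x₃ ^ 2).natDegree
        = x₃.natDegree + 2 * (fVal x₁ x₂ x₃).natDegree := by
      rw [Polynomial.natDegree_mul (ne_zero_of_natDegree_pos h₃)
        (pow_ne_zero _ (ne_zero_of_natDegree_pos hF)), Polynomial.natDegree_pow]
    have h1 := natDegree_two_mul_mul_mul_le x₁ x₂ (fVal x₁ x₂ x₃)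
    have h2 : (x₁ ^ 3).natDegree = 3 * x₁.natDegree := Polynomial.natDegree_pow _ _
    have h3 := Polynomial.natDegree_add_le (2 * x₁ * x₂ * fVal x₁ x₂ x₃) (x₁ ^ 3)
    rw [gVal, add_assoc, Polynomial.natDegree_add_eq_left_of_natDegree_lt (by omega), hm]
  exact ⟨hF, by omega, by omega, by omega⟩

/-- The case where `x₁³` is the dominant term of `g`. -/
lemma Expanding.of_x₁_dominant (hF : 1 ≤ (fVal x₁ x₂ x₃).natDegree)
    (h : x₂.natDegree + (fVal x₁ x₂ x₃).natDegree < 2 * x₁.natDegree)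
    (h' : x₃.natDegree + 2 * (fVal x₁ x₂ x₃).natDegree < 3 * x₁.natDegree) :
    Expanding x₁ x₂ x₃ := by
  have hR := natDegree_rVal_le x₁ x₂ x₃
  have hG : (gVal x₁ x₂ x₃).natDegree = 3 * x₁.natDegree := by
    have hm : (x₃ * fVal x₁ x₂ x₃ ^ 2).natDegree
        ≤ x₃.natDegree + 2 * (fVal x₁ x₂ x₃).natDegree :=
      Polynomial.natDegree_mul_le_of_le le_rfl Polynomial.natDegree_pow_le
    have h1 := natDegree_two_mul_mul_mul_le x₁ x₂ (fVal x₁ x₂ x₃)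
    have h2 : (x₁ ^ 3).natDegree = 3 * x₁.natDegree := Polynomial.natDegree_pow _ _
    have h3 := Polynomial.natDegree_add_le (x₃ * fVal x₁ x₂ x₃ ^ 2)
      (2 * x₁ * x₂ * fVal x₁ x₂ x₃)
    rw [gVal, Polynomial.natDegree_add_eq_right_of_natDegree_lt (by omega), h2]
  exact ⟨hF, by omega, by omega, by omega⟩

/-- The case where `r²` and `f³` have different degrees, using `x₁ g = r² + f³`. -/
lemma Expanding.of_r_f (hF : 1 ≤ (fVal x₁ x₂ x₃).natDegree)
    (hne : 2 * (rVal x₁ x₂ x₃).natDegree ≠ 3 * (fVal x₁ x₂ x₃).natDegree)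
    (h : 2 * x₁.natDegree < 2 * (fVal x₁ x₂ x₃).natDegree +
      max (2 * (rVal x₁ x₂ x₃).natDegree) (3 * (fVal x₁ x₂ x₃).natDegree))
    (h' : x₁.natDegree <
      max (2 * (rVal x₁ x₂ x₃).natDegree) (3 * (fVal x₁ x₂ x₃).natDegree)) :
    Expanding x₁ x₂ x₃ := by
  have hr : (rVal x₁ x₂ x₃ ^ 2).natDegree = 2 * (rVal x₁ x₂ x₃).natDegree :=
    Polynomial.natDegree_pow _ _
  have hf : (fVal x₁ x₂ x₃ ^ 3).natDegree = 3 * (fVal x₁ x₂ x₃).natDegree :=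
    Polynomial.natDegree_pow _ _
  have hM : (x₁ * gVal x₁ x₂ x₃).natDegree =
      max (2 * (rVal x₁ x₂ x₃).natDegree) (3 * (fVal x₁ x₂ x₃).natDegree) := by
    rw [x₁_mul_gVal]
    rcases lt_or_gt_of_ne hne with hlt | hlt
    · rw [Polynomial.natDegree_add_eq_right_of_natDegree_lt (by omega), hf,
        max_eq_right hlt.le]
    · rw [Polynomial.natDegree_add_eq_left_of_natDegree_lt (by omega), hr, max_eq_left hlt.le]
  have h0 : x₁ * gVal x₁ x₂ x₃ ≠ 0 := ne_zero_of_natDegree_pos (by omega)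
  rw [Polynomial.natDegree_mul (left_ne_zero_of_mul h0) (right_ne_zero_of_mul h0)] at hM
  exact ⟨hF, by omega, by omega, by omega⟩

/-- The case where `x₁ x₃` and `x₂²` have different degrees. -/
lemma Expanding.of_ne (h₁ : 1 ≤ x₁.natDegree) (h₃ : 1 ≤ x₃.natDegree)
    (h : x₁.natDegree < 3 * x₃.natDegree)
    (hne : x₁.natDegree + x₃.natDegree ≠ 2 * x₂.natDegree) : Expanding x₁ x₂ x₃ := by
  have m₁ := Polynomial.natDegree_mul (ne_zero_of_natDegree_pos h₁) (ne_zero_of_natDegree_pos h₃)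
  have m₂ : (x₂ ^ 2).natDegree = 2 * x₂.natDegree := Polynomial.natDegree_pow _ _
  have hF : x₁.natDegree + x₃.natDegree ≤ (fVal x₁ x₂ x₃).natDegree ∧
      2 * x₂.natDegree ≤ (fVal x₁ x₂ x₃).natDegree := by
    rcases lt_or_gt_of_ne hne with hlt | hlt
    · rw [fVal, Polynomial.natDegree_sub_eq_right_of_natDegree_lt (by omega)]
      omega
    · rw [fVal, Polynomial.natDegree_sub_eq_left_of_natDegree_lt (by omega)]
      omega
  exact of_x₃_dominant h₃ (by omega) (by omega) (by omega)

/-- The whole degree pattern follows from the degrees of `f`, `r` and `x₁`. -/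
lemma Attracting.of_f_r_x₁ {E D : ℕ} (hE : 1 ≤ E) (hD : E < D)
    (hf : (fVal x₁ x₂ x₃).natDegree = E) (hr : (rVal x₁ x₂ x₃).natDegree = D)
    (h₁ : x₁.natDegree = E + D) : Attracting E D x₁ x₂ x₃ := by
  have hf0 : fVal x₁ x₂ x₃ ≠ 0 := ne_zero_of_natDegree_pos (by omega)
  have h₁0 : x₁ ≠ 0 := ne_zero_of_natDegree_pos (by omega)
  have h₁2 : (x₁ ^ 2).natDegree = 2 * x₁.natDegree := Polynomial.natDegree_pow _ _
  have e₂ : x₂ * fVal x₁ x₂ x₃ = rVal x₁ x₂ x₃ - x₁ ^ 2 := by rw [rVal]; ring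
  have d₂ : (x₂ * fVal x₁ x₂ x₃).natDegree = 2 * (E + D) := by
    rw [e₂, Polynomial.natDegree_sub_eq_right_of_natDegree_lt (by omega), h₁2, h₁]
  have h₂0 : x₂ ≠ 0 := by
    rintro rfl
    simp at d₂
    omega
  rw [Polynomial.natDegree_mul h₂0 hf0] at d₂
  have h₂2 : (x₂ ^ 2).natDegree = 2 * x₂.natDegree := Polynomial.natDegree_pow _ _
  have e₃ : x₁ * x₃ = fVal x₁ x₂ x₃ + x₂ ^ 2 := by rw [fVal]; ring
  have d₃ : (x₁ * x₃).natDegree = 2 * x₂.natDegree := by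
    rw [e₃, Polynomial.natDegree_add_eq_right_of_natDegree_lt (by omega), h₂2]
  have h₃0 : x₃ ≠ 0 := by
    rintro rfl
    simp at d₃
    omega
  rw [Polynomial.natDegree_mul h₁0 h₃0] at d₃
  exact ⟨hE, hD, hf, hr, h₁, by omega, by omega⟩

lemma Expanding.attracting (h : Expanding x₁ x₂ x₃) {u v : k} (hu : u ≠ 0) (hv : v ≠ 0)
    {z₁ z₂ z₃ : Polynomial k}
    (h₁ : z₁ = Polynomial.C (v ^ 3) * (x₁ - 2 * Polynomial.C u * rVal x₁ x₂ x₃ * fVal x₁ x₂ x₃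
      + Polynomial.C u ^ 2 * fVal x₁ x₂ x₃ ^ 2 * gVal x₁ x₂ x₃))
    (hr : rVal z₁ z₂ z₃ = Polynomial.C (v ^ 6) *
      (rVal x₁ x₂ x₃ - Polynomial.C u * fVal x₁ x₂ x₃ * gVal x₁ x₂ x₃))
    (hf : fVal z₁ z₂ z₃ = Polynomial.C (v ^ 4) * fVal x₁ x₂ x₃) :
    ∃ E D, Attracting E D z₁ z₂ z₃ := by
  obtain ⟨hF, hG, hR, hX⟩ := h
  refine ⟨_, _, Attracting.of_f_r_x₁ (E := (fVal x₁ x₂ x₃).natDegree)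
    (D := (fVal x₁ x₂ x₃).natDegree + (gVal x₁ x₂ x₃).natDegree) hF (by omega) ?_ ?_ ?_⟩
  · rw [hf, Polynomial.natDegree_C_mul (pow_ne_zero _ hv)]
  · have hm := Polynomial.natDegree_mul (ne_zero_of_natDegree_pos hF) (ne_zero_of_natDegree_pos hG)
    have e : rVal x₁ x₂ x₃ - Polynomial.C u * fVal x₁ x₂ x₃ * gVal x₁ x₂ x₃ =
        Polynomial.C (-u) * (fVal x₁ x₂ x₃ * gVal x₁ x₂ x₃) + rVal x₁ x₂ x₃ := by
      rw [map_neg]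
      ring
    rw [hr, Polynomial.natDegree_C_mul (pow_ne_zero _ hv), e,
      natDegree_C_mul_add_eq (neg_ne_zero.mpr hu) (by omega), hm]
  · have hm : (fVal x₁ x₂ x₃ ^ 2 * gVal x₁ x₂ x₃).natDegree =
        2 * (fVal x₁ x₂ x₃).natDegree + (gVal x₁ x₂ x₃).natDegree := by
      rw [Polynomial.natDegree_mul (pow_ne_zero _ (ne_zero_of_natDegree_pos hF))
        (ne_zero_of_natDegree_pos hG), Polynomial.natDegree_pow]
    have e : x₁ - 2 * Polynomial.C u * rVal x₁ x₂ x₃ * fVal x₁ x₂ x₃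
        + Polynomial.C u ^ 2 * fVal x₁ x₂ x₃ ^ 2 * gVal x₁ x₂ x₃ =
        Polynomial.C (u ^ 2) * (fVal x₁ x₂ x₃ ^ 2 * gVal x₁ x₂ x₃) +
          (Polynomial.C (-2 * u) * (rVal x₁ x₂ x₃ * fVal x₁ x₂ x₃) + x₁) := by
      simp only [map_mul, map_pow, map_neg, Polynomial.C_ofNat]
      ring
    have hrf : (rVal x₁ x₂ x₃ * fVal x₁ x₂ x₃).natDegree ≤ _ := Polynomial.natDegree_mul_le
    have hq := natDegree_C_mul_add_le (-2 * u) (m := rVal x₁ x₂ x₃ * fVal x₁ x₂ x₃) (q := x₁)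
      (n := 2 * (fVal x₁ x₂ x₃).natDegree + (gVal x₁ x₂ x₃).natDegree - 1) (by omega) (by omega)
    rw [h₁, Polynomial.natDegree_C_mul (pow_ne_zero _ hv), e,
      natDegree_C_mul_add_eq (pow_ne_zero _ hu) (by omega), hm]
    omega

/-- An affine combination of the coordinates of a point. -/
def affVal (x₁ x₂ x₃ : Polynomial k) (a b c d : k) : Polynomial k :=
  Polynomial.C c * x₃ + (Polynomial.C b * x₂ + (Polynomial.C a * x₁ + Polynomial.C d))

lemma fVal_affVal (x₁ x₂ x₃ : Polynomial k) (a₁ b₁ c₁ d₁ a₂ b₂ c₂ d₂ a₃ b₃ c₃ d₃ : k) :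
    fVal (affVal x₁ x₂ x₃ a₁ b₁ c₁ d₁) (affVal x₁ x₂ x₃ a₂ b₂ c₂ d₂)
      (affVal x₁ x₂ x₃ a₃ b₃ c₃ d₃) =
    Polynomial.C (c₁ * c₃ - c₂ ^ 2) * x₃ ^ 2 +
    (Polynomial.C (b₁ * c₃ + c₁ * b₃ - 2 * b₂ * c₂) * (x₂ * x₃) +
    (Polynomial.C (b₁ * b₃ - b₂ ^ 2 + (a₁ * c₃ + c₁ * a₃ - 2 * a₂ * c₂)) * x₂ ^ 2 +
    (Polynomial.C (a₁ * b₃ + b₁ * a₃ - 2 * a₂ * b₂) * (x₁ * x₂) +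
    (Polynomial.C (c₁ * d₃ + d₁ * c₃ - 2 * c₂ * d₂) * x₃ +
    (Polynomial.C (a₁ * a₃ - a₂ ^ 2) * x₁ ^ 2 +
    (Polynomial.C (b₁ * d₃ + d₁ * b₃ - 2 * b₂ * d₂) * x₂ +
    (Polynomial.C (a₁ * d₃ + d₁ * a₃ - 2 * a₂ * d₂) * x₁ +
    (Polynomial.C (a₁ * c₃ + c₁ * a₃ - 2 * a₂ * c₂) * fVal x₁ x₂ x₃ +
      Polynomial.C (d₁ * d₃ - d₂ ^ 2))))))))) := by
  simp only [fVal, affVal, map_add, map_sub, map_mul, map_pow, Polynomial.C_ofNat]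
  ring

namespace Attracting

variable {E D : ℕ}

lemma natDegree_mul (h : Attracting E D x₁ x₂ x₃) :
    (x₃ ^ 2).natDegree = 2 * E + 6 * D ∧ (x₂ * x₃).natDegree = 2 * E + 5 * D ∧
    (x₂ ^ 2).natDegree = 2 * E + 4 * D ∧ (x₁ * x₂).natDegree = 2 * E + 3 * D ∧
    (x₁ ^ 2).natDegree = 2 * E + 2 * D := by
  have hpos := h.pos
  have h₁ := h.x₁
  have h₂ := h.x₂
  have h₃ := h.x₃
  have n₁ : x₁ ≠ 0 := ne_zero_of_natDegree_pos (by omega)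
  have n₂ : x₂ ≠ 0 := ne_zero_of_natDegree_pos (by omega)
  have n₃ : x₃ ≠ 0 := ne_zero_of_natDegree_pos (by omega)
  rw [Polynomial.natDegree_mul n₂ n₃, Polynomial.natDegree_mul n₁ n₂, Polynomial.natDegree_pow,
    Polynomial.natDegree_pow, Polynomial.natDegree_pow]
  omega

/-- The terms of the expansion `fVal_affVal` have pairwise different degrees. -/
lemma combination (h : Attracting E D x₁ x₂ x₃) (q₁ q₂ q₃ q₄ q₅ q₆ q₇ q₈ q₉ q₀ : k)
    {p : Polynomial k}
    (hp : p = Polynomial.C q₁ * x₃ ^ 2 + (Polynomial.C q₂ * (x₂ * x₃) +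
      (Polynomial.C q₃ * x₂ ^ 2 + (Polynomial.C q₄ * (x₁ * x₂) + (Polynomial.C q₅ * x₃ +
      (Polynomial.C q₆ * x₁ ^ 2 + (Polynomial.C q₇ * x₂ + (Polynomial.C q₈ * x₁ +
      (Polynomial.C q₉ * fVal x₁ x₂ x₃ + Polynomial.C q₀))))))))) :
    (p.natDegree < 2 * E + 6 * D → q₁ = 0) ∧
    (p.natDegree < 2 * E + 5 * D → q₂ = 0) ∧
    (p.natDegree < 2 * E + 4 * D → q₃ = 0 ∧ p.natDegree ≤ 2 * E + 3 * D) ∧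
    (p.natDegree < 2 * E + 3 * D → q₄ = 0) ∧
    (p.natDegree < E + 3 * D → q₅ = 0) ∧
    (p.natDegree < 2 * E + 2 * D → q₆ = 0) ∧
    (p.natDegree < E + 2 * D → q₇ = 0) ∧
    (p.natDegree < E + D → q₈ = 0) ∧
    (p.natDegree < E → q₉ = 0) := by
  obtain ⟨m₁, m₂, m₃, m₄, m₆⟩ := h.natDegree_mul
  obtain ⟨hpos, hlt, m₉, -, m₈, m₇, m₅⟩ := h
  have key : ∀ {q : k} {m t s : Polynomial k} {n n' : ℕ}, s = Polynomial.C q * m + t →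
      m.natDegree = n → t.natDegree ≤ n' → n' < n →
      s.natDegree ≤ n ∧ (s.natDegree < n → q = 0 ∧ s = t) := by
    intro q m t s n n' hs hm ht hn
    subst hs
    refine ⟨natDegree_C_mul_add_le _ hm.le (by omega), fun hlt' => ?_⟩
    have hq : q = 0 := by
      by_contra hq
      have := natDegree_C_mul_add_eq hq (m := m) (q := t) (by omega)
      omega
    exact ⟨hq, by simp [hq]⟩
  have t₀ : (Polynomial.C q₀).natDegree ≤ 0 := by simp
  obtain ⟨t₉, k₉⟩ := key (q := q₉) rfl m₉ t₀ (by omega)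
  obtain ⟨t₈, k₈⟩ := key (q := q₈) rfl m₈ t₉ (by omega)
  obtain ⟨t₇, k₇⟩ := key (q := q₇) rfl m₇ t₈ (by omega)
  obtain ⟨t₆, k₆⟩ := key (q := q₆) rfl m₆ t₇ (by omega)
  obtain ⟨t₅, k₅⟩ := key (q := q₅) rfl m₅ t₆ (by omega)
  obtain ⟨t₄, k₄⟩ := key (q := q₄) rfl m₄ t₅ (by omega)
  obtain ⟨t₃, k₃⟩ := key (q := q₃) rfl m₃ t₄ (by omega)
  obtain ⟨t₂, k₂⟩ := key (q := q₂) rfl m₂ t₃ (by omega)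
  obtain ⟨-, k₁⟩ := key (q := q₁) hp m₁ t₂ (by omega)
  clear hp key
  have s₂ : p.natDegree < 2 * E + 5 * D → q₂ = 0 ∧ p = _ := fun hd => by
    obtain ⟨-, e⟩ := k₁ (by omega)
    rw [← e] at k₂
    exact k₂ hd
  have s₃ : p.natDegree < 2 * E + 4 * D → q₃ = 0 ∧ p = _ := fun hd => by
    obtain ⟨-, e⟩ := s₂ (by omega)
    rw [← e] at k₃
    exact k₃ hd
  have s₄ : p.natDegree < 2 * E + 3 * D → q₄ = 0 ∧ p = _ := fun hd => by
    obtain ⟨-, e⟩ := s₃ (by omega)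
    rw [← e] at k₄
    exact k₄ hd
  have s₅ : p.natDegree < E + 3 * D → q₅ = 0 ∧ p = _ := fun hd => by
    obtain ⟨-, e⟩ := s₄ (by omega)
    rw [← e] at k₅
    exact k₅ hd
  have s₆ : p.natDegree < 2 * E + 2 * D → q₆ = 0 ∧ p = _ := fun hd => by
    obtain ⟨-, e⟩ := s₅ (by omega)
    rw [← e] at k₆
    exact k₆ hd
  have s₇ : p.natDegree < E + 2 * D → q₇ = 0 ∧ p = _ := fun hd => by
    obtain ⟨-, e⟩ := s₆ (by omega)
    rw [← e] at k₇
    exact k₇ hd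
  have s₈ : p.natDegree < E + D → q₈ = 0 ∧ p = _ := fun hd => by
    obtain ⟨-, e⟩ := s₇ (by omega)
    rw [← e] at k₈
    exact k₈ hd
  refine ⟨fun hd => (k₁ hd).1, fun hd => (s₂ hd).1, fun hd => ⟨(s₃ hd).1, ?_⟩,
    fun hd => (s₄ hd).1, fun hd => (s₅ hd).1, fun hd => (s₆ hd).1, fun hd => (s₇ hd).1,
    fun hd => (s₈ hd).1, fun hd => ?_⟩
  · rw [(s₃ hd).2]
    exact t₄
  · obtain ⟨-, e⟩ := s₈ (by omega)
    rw [← e] at k₉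
    exact (k₉ hd).1

lemma natDegree_affVal (h : Attracting E D x₁ x₂ x₃) (a b c d : k) :
    (c ≠ 0 ∧ (affVal x₁ x₂ x₃ a b c d).natDegree = E + 3 * D) ∨
    (c = 0 ∧ b ≠ 0 ∧ (affVal x₁ x₂ x₃ a b c d).natDegree = E + 2 * D) ∨
    (c = 0 ∧ b = 0 ∧ a ≠ 0 ∧ (affVal x₁ x₂ x₃ a b c d).natDegree = E + D) ∨
    (c = 0 ∧ b = 0 ∧ a = 0) := by
  obtain ⟨hpos, hlt, -, -, h₁, h₂, h₃⟩ := h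
  have t₀ : (Polynomial.C d).natDegree = 0 := by simp
  have t₁ := natDegree_C_mul_add_le a (m := x₁) (q := Polynomial.C d) h₁.le (by omega)
  have t₂ := natDegree_C_mul_add_le b (m := x₂) h₂.le (t₁.trans (by omega))
  by_cases hc : c = 0
  · by_cases hb : b = 0
    · by_cases ha : a = 0
      · simp [ha, hb, hc]
      · refine .inr (.inr (.inl ⟨hc, hb, ha, ?_⟩))
        simp only [affVal, hc, hb, map_zero, zero_mul, zero_add]
        rw [natDegree_C_mul_add_eq ha (by omega), h₁]
    · refine .inr (.inl ⟨hc, hb, ?_⟩)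
      simp only [affVal, hc, map_zero, zero_mul, zero_add]
      rw [natDegree_C_mul_add_eq hb (by omega), h₂]
  · refine .inl ⟨hc, ?_⟩
    rw [affVal, natDegree_C_mul_add_eq hc (by omega), h₃]

/-- If all three coordinates and `f` have the degree of `x₃` after an affine substitution,
then the degree of `r` avoids the interval `(2E+4D, 2E+5D)`. -/
lemma natDegree_rVal_affVal (h : Attracting E D x₁ x₂ x₃) {q₅ q₆ q₇ q₈ q₉ q₀ : k}
    {a₁ b₁ c₁ d₁ a₂ b₂ c₂ d₂ : k} (hc₂ : c₂ ≠ 0) {p : Polynomial k}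
    (hp : p = Polynomial.C q₅ * x₃ + (Polynomial.C q₆ * x₁ ^ 2 + (Polynomial.C q₇ * x₂ +
      (Polynomial.C q₈ * x₁ + (Polynomial.C q₉ * fVal x₁ x₂ x₃ + Polynomial.C q₀))))) :
    2 * E + 5 * D ≤
      (affVal x₁ x₂ x₃ a₂ b₂ c₂ d₂ * p + affVal x₁ x₂ x₃ a₁ b₁ c₁ d₁ ^ 2).natDegree ∨
    (affVal x₁ x₂ x₃ a₂ b₂ c₂ d₂ * p + affVal x₁ x₂ x₃ a₁ b₁ c₁ d₁ ^ 2).natDegree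
      ≤ 2 * E + 4 * D := by
  obtain ⟨m₁, m₂, m₃, m₄, m₆⟩ := h.natDegree_mul
  obtain ⟨hpos, hlt, hf, -, h₁, h₂, h₃⟩ := h
  have n₁ : x₁ ≠ 0 := ne_zero_of_natDegree_pos (by omega)
  have n₃ : x₃ ≠ 0 := ne_zero_of_natDegree_pos (by omega)
  have m₁₁₃ : (x₁ ^ 2 * x₃).natDegree = 3 * E + 5 * D := by
    rw [Polynomial.natDegree_mul (pow_ne_zero _ n₁) n₃]
    omega
  have m₁₃ : (x₁ * x₃).natDegree = 2 * E + 4 * D := by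
    rw [Polynomial.natDegree_mul n₁ n₃]
    omega
  have y₂ := natDegree_C_mul_add_le b₂ (m := x₂) (n := E + 2 * D) h₂.le
    (natDegree_C_mul_add_le a₂ (m := x₁) (q := Polynomial.C d₂) (by omega) (by simp))
  have y₁ := natDegree_C_mul_add_le b₁ (m := x₂) (n := E + 2 * D) h₂.le
    (natDegree_C_mul_add_le a₁ (m := x₁) (q := Polynomial.C d₁) (by omega) (by simp))
  have l₁ := natDegree_C_mul_add_le a₁ (m := x₁) (q := Polynomial.C d₁) (n := E + D)
    (by omega) (by simp)
  have l₂ := natDegree_C_mul_add_le a₂ (m := x₁) (q := Polynomial.C d₂) (n := E + D)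
    (by omega) (by simp)
  have w₈ := natDegree_C_mul_add_le q₈ (m := x₁) (n := E + D) h₁.le
    (natDegree_C_mul_add_le q₉ (m := fVal x₁ x₂ x₃) (q := Polynomial.C q₀) (by omega) (by simp))
  have w₇ := natDegree_C_mul_add_le q₇ (m := x₂) (n := E + 2 * D) h₂.le (w₈.trans (by omega))
  set M₁ := Polynomial.C a₁ * x₁ + Polynomial.C d₁ with hM₁
  set M₂ := Polynomial.C a₂ * x₁ + Polynomial.C d₂ with hM₂
  set L₁ := Polynomial.C b₁ * x₂ + M₁ with hL₁
  set L₂ := Polynomial.C b₂ * x₂ + M₂ with hL₂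
  set W₈ := Polynomial.C q₈ * x₁ + (Polynomial.C q₉ * fVal x₁ x₂ x₃ + Polynomial.C q₀)
  set W₇ := Polynomial.C q₇ * x₂ + W₈ with hW₇
  set S := x₃ * (Polynomial.C c₂ * W₈ + (Polynomial.C q₅ * M₂ + Polynomial.C (2 * c₁) * M₁))
    + (W₇ * L₂ + L₁ ^ 2) with hS
  have s : S.natDegree ≤ 2 * E + 4 * D := by
    have t := natDegree_C_mul_add_le c₂ w₈ (natDegree_C_mul_add_le q₅ l₂
      ((Polynomial.natDegree_C_mul_le (2 * c₁) M₁).trans l₁))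
    refine Polynomial.natDegree_add_le_of_degree_le
      ((Polynomial.natDegree_mul_le_of_le h₃.le t).trans (by omega))
      (Polynomial.natDegree_add_le_of_degree_le
        ((Polynomial.natDegree_mul_le_of_le w₇ y₂).trans (by omega))
        ((Polynomial.natDegree_pow_le_of_le 2 y₁).trans (by omega)))
  have e : affVal x₁ x₂ x₃ a₂ b₂ c₂ d₂ * p + affVal x₁ x₂ x₃ a₁ b₁ c₁ d₁ ^ 2 =
      Polynomial.C (c₂ * q₅ + c₁ ^ 2) * x₃ ^ 2 + (Polynomial.C (c₂ * q₆) * (x₁ ^ 2 * x₃) +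
      (Polynomial.C (c₂ * q₇ + q₅ * b₂ + 2 * c₁ * b₁) * (x₂ * x₃) +
      (Polynomial.C q₆ * (x₁ ^ 2 * L₂) + S))) := by
    simp only [hp, affVal, hS, ← hM₁, ← hM₂, ← hL₁, ← hL₂]
    simp only [hW₇, hL₁, hL₂, map_add, map_mul, map_pow, Polynomial.C_ofNat]
    ring
  have y₃ : (x₁ ^ 2 * L₂).natDegree ≤ 3 * E + 4 * D :=
    (Polynomial.natDegree_mul_le_of_le m₆.le y₂).trans (by omega)
  have r₃ := natDegree_C_mul_add_le q₆ y₃ (s.trans (by omega))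
  have r₂ := natDegree_C_mul_add_le (c₂ * q₇ + q₅ * b₂ + 2 * c₁ * b₁) (m := x₂ * x₃)
    (n := 3 * E + 5 * D - 1) (by omega) (r₃.trans (by omega))
  have r₁ := natDegree_C_mul_add_le (c₂ * q₆) (m := x₁ ^ 2 * x₃) m₁₁₃.le (r₂.trans (by omega))
  rw [e]
  by_cases k₁ : c₂ * q₅ + c₁ ^ 2 = 0
  · rw [k₁, map_zero, zero_mul, zero_add]
    by_cases k₂ : q₆ = 0
    · rw [k₂, mul_zero, map_zero, zero_mul, zero_add, zero_mul, zero_add]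
      by_cases k₃ : c₂ * q₇ + q₅ * b₂ + 2 * c₁ * b₁ = 0
      · rw [k₃, map_zero, zero_mul, zero_add]
        exact .inr s
      · left
        rw [natDegree_C_mul_add_eq k₃ (by omega)]
        omega
    · left
      rw [natDegree_C_mul_add_eq (mul_ne_zero hc₂ k₂) (by omega)]
      omega
  · left
    rw [natDegree_C_mul_add_eq k₁ (by omega)]
    omega

/-- An affine substitution outside `B` sends attracting points to expanding ones. -/
lemma expanding_affVal [CharZero k] (h : Attracting E D x₁ x₂ x₃)
    {a₁ b₁ c₁ d₁ a₂ b₂ c₂ d₂ a₃ b₃ c₃ d₃ : k}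
    (hdet : a₁ * (b₂ * c₃ - b₃ * c₂) - a₂ * (b₁ * c₃ - b₃ * c₁) + a₃ * (b₁ * c₂ - b₂ * c₁) ≠ 0)
    (hB : ¬ (a₁ = c₃ ^ 3 ∧ b₁ = 0 ∧ c₁ = 0 ∧ d₁ = 0 ∧ a₂ = 0 ∧ b₂ = c₃ ^ 2 ∧ c₂ = 0 ∧ d₂ = 0 ∧
      a₃ = 0 ∧ b₃ = 0 ∧ d₃ = 0)) :
    Expanding (affVal x₁ x₂ x₃ a₁ b₁ c₁ d₁) (affVal x₁ x₂ x₃ a₂ b₂ c₂ d₂)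
      (affVal x₁ x₂ x₃ a₃ b₃ c₃ d₃) := by
  have hpos := h.pos
  have hlt := h.lt
  have hF := fVal_affVal x₁ x₂ x₃ a₁ b₁ c₁ d₁ a₂ b₂ c₂ d₂ a₃ b₃ c₃ d₃
  have hq := h.combination _ _ _ _ _ _ _ _ _ _ hF
  have hy₁ := h.natDegree_affVal a₁ b₁ c₁ d₁
  have hy₂ := h.natDegree_affVal a₂ b₂ c₂ d₂
  have hy₃ := h.natDegree_affVal a₃ b₃ c₃ d₃
  have hr := fun hc p => h.natDegree_rVal_affVal (a₁ := a₁) (b₁ := b₁) (c₁ := c₁) (d₁ := d₁)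
    (a₂ := a₂) (b₂ := b₂) (c₂ := c₂) (d₂ := d₂) hc (p := p)
    (q₅ := c₁ * d₃ + d₁ * c₃ - 2 * c₂ * d₂) (q₆ := a₁ * a₃ - a₂ ^ 2)
    (q₇ := b₁ * d₃ + d₁ * b₃ - 2 * b₂ * d₂) (q₈ := a₁ * d₃ + d₁ * a₃ - 2 * a₂ * d₂)
    (q₉ := a₁ * c₃ + c₁ * a₃ - 2 * a₂ * c₂) (q₀ := d₁ * d₃ - d₂ ^ 2)
  have hr' : a₁ ≠ 0 → b₁ = 0 → c₁ = 0 → d₁ = 0 → c₂ = 0 → d₂ = 0 → d₃ = 0 →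
      ¬ (a₁ = b₂ * c₃ ∧ a₂ = 0) → a₁ * c₃ - b₂ ^ 2 = 0 →
      fVal (affVal x₁ x₂ x₃ a₁ b₁ c₁ d₁) (affVal x₁ x₂ x₃ a₂ b₂ c₂ d₂)
        (affVal x₁ x₂ x₃ a₃ b₃ c₃ d₃) = Polynomial.C (a₁ * c₃) * fVal x₁ x₂ x₃ →
      2 * E + D ≤ (rVal (affVal x₁ x₂ x₃ a₁ b₁ c₁ d₁) (affVal x₁ x₂ x₃ a₂ b₂ c₂ d₂)
        (affVal x₁ x₂ x₃ a₃ b₃ c₃ d₃)).natDegree := by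
    intro ha₁ hb₁ hc₁ hd₁ hc₂ hd₂ hd₃ hn hac hf
    have m₁ := h.natDegree_mul.2.2.2.2
    have n₁ : x₁ ≠ 0 := ne_zero_of_natDegree_pos (by rw [h.x₁]; omega)
    have nf : fVal x₁ x₂ x₃ ≠ 0 := ne_zero_of_natDegree_pos (by rw [h.f]; omega)
    have m₂ : (x₁ * fVal x₁ x₂ x₃).natDegree = 2 * E + D := by
      rw [Polynomial.natDegree_mul n₁ nf, h.f, h.x₁]
      omega
    have m₃ : (Polynomial.C (a₁ * b₂ * c₃) * rVal x₁ x₂ x₃).natDegree ≤ D :=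
      (Polynomial.natDegree_C_mul_le _ _).trans h.r.le
    have e : rVal (affVal x₁ x₂ x₃ a₁ b₁ c₁ d₁) (affVal x₁ x₂ x₃ a₂ b₂ c₂ d₂)
        (affVal x₁ x₂ x₃ a₃ b₃ c₃ d₃) =
        Polynomial.C (a₁ * (a₁ - b₂ * c₃)) * x₁ ^ 2 +
        (Polynomial.C (a₁ * a₂ * c₃) * (x₁ * fVal x₁ x₂ x₃) +
          Polynomial.C (a₁ * b₂ * c₃) * rVal x₁ x₂ x₃) := by
      rw [rVal, hf, rVal]
      simp only [affVal, hb₁, hc₁, hd₁, hc₂, hd₂, map_sub, map_mul, map_zero]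
      ring
    have hc₃ : c₃ ≠ 0 := by
      rintro rfl
      apply hdet
      rw [hc₁, hc₂]
      ring
    have m₄ := natDegree_C_mul_add_le (a₁ * a₂ * c₃) m₂.le (m₃.trans (by omega))
    rw [e]
    by_cases k₁ : a₁ = b₂ * c₃
    · rw [← k₁, sub_self, mul_zero, map_zero, zero_mul, zero_add, k₁, ← k₁,
        natDegree_C_mul_add_eq (mul_ne_zero (mul_ne_zero ha₁ fun h0 => hn ⟨k₁, h0⟩) hc₃), m₂]
      omega
    · rw [natDegree_C_mul_add_eq (mul_ne_zero ha₁ (sub_ne_zero.mpr k₁)) (by omega)]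
      omega
  generalize hy₁' : affVal x₁ x₂ x₃ a₁ b₁ c₁ d₁ = y₁ at *
  generalize hy₂' : affVal x₁ x₂ x₃ a₂ b₂ c₂ d₂ = y₂ at *
  generalize hy₃' : affVal x₁ x₂ x₃ a₃ b₃ c₃ d₃ = y₃ at *
  obtain ⟨k₁, k₂, k₃, k₄, k₅, k₆, k₇, k₈, k₉⟩ := hq
  have hFpos : 1 ≤ (fVal y₁ y₂ y₃).natDegree := by
    by_contra hF0
    refine hdet (pow_eq_zero_iff two_ne_zero |>.mp ?_)
    have j₁ := k₁ (by omega)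
    have j₂ := k₂ (by omega)
    have j₃ := (k₃ (by omega)).1
    have j₄ := k₄ (by omega)
    have j₆ := k₆ (by omega)
    have j₉ := k₉ (by omega)
    rw [j₉, add_zero] at j₃
    linear_combination (4 * (b₁ * b₃ - b₂ ^ 2) * (a₁ * a₃ - a₂ ^ 2)
      - (a₁ * b₃ + b₁ * a₃ - 2 * a₂ * b₂) ^ 2) * j₁
      + ((a₁ * b₃ + b₁ * a₃ - 2 * a₂ * b₂) * (a₁ * c₃ + c₁ * a₃ - 2 * a₂ * c₂)
      - (a₁ * a₃ - a₂ ^ 2) * (b₁ * c₃ + c₁ * b₃ - 2 * b₂ * c₂)) * j₂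
      - (a₁ * c₃ + c₁ * a₃ - 2 * a₂ * c₂) ^ 2 * j₃
  by_cases hne : y₁.natDegree + y₃.natDegree ≠ 2 * y₂.natDegree
  · have hz₁ : ¬ (c₁ = 0 ∧ b₁ = 0 ∧ a₁ = 0) := by
      rintro ⟨z₁, z₂, z₃⟩
      exact hdet (by rw [z₁, z₂, z₃]; ring)
    have hz₃ : ¬ (c₃ = 0 ∧ b₃ = 0 ∧ a₃ = 0) := by
      rintro ⟨z₁, z₂, z₃⟩
      exact hdet (by rw [z₁, z₂, z₃]; ring)
    have l₁ : E + D ≤ y₁.natDegree ∧ y₁.natDegree ≤ E + 3 * D := by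
      rcases hy₁ with ⟨-, e₁⟩ | ⟨-, -, e₁⟩ | ⟨-, -, -, e₁⟩ | hz
      · omega
      · omega
      · omega
      · exact absurd hz hz₁
    have l₃ : E + D ≤ y₃.natDegree := by
      rcases hy₃ with ⟨-, e₃⟩ | ⟨-, -, e₃⟩ | ⟨-, -, -, e₃⟩ | hz
      · omega
      · omega
      · omega
      · exact absurd hz hz₃
    exact Expanding.of_ne (by omega) (by omega) (by omega) hne
  rw [not_not] at hne
  rcases hy₁ with ⟨hc₁, e₁⟩ | ⟨hc₁, hb₁, e₁⟩ | ⟨hc₁, hb₁, ha₁, e₁⟩ | ⟨hc₁, hb₁, ha₁⟩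
  rotate_right
  · exact absurd (by rw [hc₁, hb₁, ha₁]; ring) hdet
  all_goals
    rcases hy₂ with ⟨hc₂, e₂⟩ | ⟨hc₂, hb₂, e₂⟩ | ⟨hc₂, hb₂, ha₂, e₂⟩ | ⟨hc₂, hb₂, ha₂⟩
    rotate_right
    · exact absurd (by rw [hc₂, hb₂, ha₂]; ring) hdet
  all_goals
    rcases hy₃ with ⟨hc₃, e₃⟩ | ⟨hc₃, hb₃, e₃⟩ | ⟨hc₃, hb₃, ha₃, e₃⟩ | ⟨hc₃, hb₃, ha₃⟩
    rotate_right
    · exact absurd (by rw [hc₃, hb₃, ha₃]; ring) hdet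
  all_goals try omega
  · rcases lt_trichotomy (fVal y₁ y₂ y₃).natDegree (E + 3 * D) with hlt' | heq | hgt
    · exact Expanding.of_x₁_dominant hFpos (by omega) (by omega)
    · have hR := hr hc₂ (fVal y₁ y₂ y₃) (by
        rw [hF, k₁ (by omega), k₂ (by omega), (k₃ (by omega)).1, k₄ (by omega)]
        simp only [map_zero, zero_mul, zero_add])
      have hrv : y₂ * fVal y₁ y₂ y₃ + y₁ ^ 2 = rVal y₁ y₂ y₃ := rfl
      rw [hrv] at hR
      exact Expanding.of_r_f hFpos (by omega) (by omega) (by omega)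
    · exact Expanding.of_x₃_dominant (by omega) hFpos (by omega) (by omega)
  · by_cases hlt' : (fVal y₁ y₂ y₃).natDegree < 2 * E + 4 * D
    · have := (k₃ hlt').2
      exact Expanding.of_x₁_dominant hFpos (by omega) (by omega)
    · exact Expanding.of_x₃_dominant (by omega) hFpos (by omega) (by omega)
  · exact absurd (by rw [hc₁, hc₂, hc₃]; ring) hdet
  · by_cases hE : (fVal y₁ y₂ y₃).natDegree ≤ E
    · have j₃ := (k₃ (by omega)).1
      have j₄ := k₄ (by omega)
      have j₅ := k₅ (by omega)
      have j₆ := k₆ (by omega)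
      have j₇ := k₇ (by omega)
      have j₈ := k₈ (by omega)
      have hd₁ : d₁ = 0 := by
        simpa [hc₁, hc₂, hc₃] using j₅
      have hd₂ : d₂ = 0 := by
        simpa [hb₁, hd₁, hb₂] using j₇
      have hd₃ : d₃ = 0 := by
        simpa [hd₁, hd₂, ha₁] using j₈
      have hac : a₁ * c₃ - b₂ ^ 2 = 0 := by
        rw [hb₁, hc₁, hc₂] at j₃
        linear_combination j₃
      have hf : fVal y₁ y₂ y₃ = Polynomial.C (a₁ * c₃) * fVal x₁ x₂ x₃ := by
        rw [hF, k₁ (by omega), k₂ (by omega), j₃, j₄, j₅, j₆, j₇, j₈, hd₁, hd₂, hc₁, hc₂]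
        simp
      have hn : ¬ (a₁ = b₂ * c₃ ∧ a₂ = 0) := by
        rintro ⟨ha, ha₂⟩
        have hb₃ : b₃ = 0 := by simpa [hb₁, ha₂, ha₁] using j₄
        have ha₃ : a₃ = 0 := by simpa [ha₂, ha₁] using j₆
        have hb : b₂ = c₃ ^ 2 := by
          refine mul_left_cancel₀ hb₂ ?_
          rw [ha] at hac
          linear_combination -hac
        exact hB ⟨by rw [ha, hb]; ring, hb₁, hc₁, hd₁, ha₂, hb, hc₂, hd₂, ha₃, hb₃, hd₃⟩
      have hR := hr' ha₁ hb₁ hc₁ hd₁ hc₂ hd₂ hd₃ hn hac hf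
      have hfE : (fVal y₁ y₂ y₃).natDegree = E := by
        by_contra hfE
        have := k₉ (by omega)
        simp [hc₁, hc₂, ha₁, hc₃] at this
      exact Expanding.of_r_f hFpos (by omega) (by omega) (by omega)
    · exact Expanding.of_x₃_dominant (by omega) hFpos (by omega) (by omega)
  · exact absurd (by rw [hb₁, hc₁, hb₂, hc₂]; ring) hdet

end Attracting

end Curves

/-! ### The group generated by `φ` and `B` -/

section Group

/-- `ρ` acts on `x₁`, `r`, `f`, `g` like `exp(uΔ) ∘ β_v`. -/
def IsExpBeta (u v : k) (ρ : MvPolynomial (Fin 3) k ≃ₐ[k] MvPolynomial (Fin 3) k) : Prop :=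
  ρ (X 0) = C v ^ 3 * (X 0 - 2 * C u * rP * fP + C u ^ 2 * fP ^ 2 * gP) ∧
  ρ rP = C v ^ 6 * (rP - C u * fP * gP) ∧ ρ fP = C v ^ 4 * fP ∧ ρ gP = C v ^ 9 * gP

lemma algEquiv_C (ρ : MvPolynomial (Fin 3) k ≃ₐ[k] MvPolynomial (Fin 3) k) (a : k) :
    ρ (C a) = C a := ρ.commutes a

lemma IsExpBeta.mul {u v u' v' : k} {ρ ρ' : MvPolynomial (Fin 3) k ≃ₐ[k] MvPolynomial (Fin 3) k}
    (h : IsExpBeta u v ρ) (h' : IsExpBeta u' v' ρ') :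
    IsExpBeta (u + u' * v ^ 7) (v * v') (ρ * ρ') := by
  obtain ⟨hx, hr, hf, hg⟩ := h
  obtain ⟨hx', hr', hf', hg'⟩ := h'
  refine ⟨?_, ?_, ?_, ?_⟩
  all_goals
    simp only [AlgEquiv.mul_apply, hx', hr', hf', hg', map_mul, map_add, map_sub, map_pow,
      map_ofNat, algEquiv_C, hx, hr, hf, hg]
    ring

lemma IsExpBeta.inv {u v : k} (hv : v ≠ 0)
    {ρ : MvPolynomial (Fin 3) k ≃ₐ[k] MvPolynomial (Fin 3) k} (h : IsExpBeta u v ρ) :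
    IsExpBeta (-(u * v⁻¹ ^ 7)) v⁻¹ ρ⁻¹ := by
  obtain ⟨hx, hr, hf, hg⟩ := h
  have hp : ∀ n : ℕ, (C v⁻¹ : MvPolynomial (Fin 3) k) ^ n * C v ^ n = 1 := fun n => by
    rw [← mul_pow, ← C_mul, inv_mul_cancel₀ hv, C_1, one_pow]
  have key : ∀ {y z}, ρ z = y → ρ⁻¹ y = z := fun {y z} hy => by
    rw [← hy, ← AlgEquiv.mul_apply, inv_mul_cancel, AlgEquiv.one_apply]
  refine ⟨key ?_, key ?_, key ?_, key ?_⟩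
  all_goals
    simp only [map_mul, map_add, map_sub, map_neg, map_pow, map_ofNat, algEquiv_C, hx, hr, hf, hg]
  · linear_combination (X 0 - 2 * C u * rP * fP + C u ^ 2 * fP ^ 2 * gP) * hp 3
      + 2 * C u * (rP - C u * fP * gP) * fP * hp 10 + C u ^ 2 * fP ^ 2 * gP * hp 17
  · linear_combination (rP - C u * fP * gP) * hp 6 + C u * fP * gP * hp 13
  · linear_combination fP * hp 4
  · linear_combination gP * hp 9

lemma fP_ne_zero : (fP : MvPolynomial (Fin 3) k) ≠ 0 := fun h => by
  have := congrArg (MvPolynomial.eval ![1, 0, 1]) h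
  simp [fP] at this

lemma IsExpBeta.mem_BSet {v : k} (hv : v ≠ 0)
    {ρ : MvPolynomial (Fin 3) k ≃ₐ[k] MvPolynomial (Fin 3) k} (h : IsExpBeta 0 v ρ) :
    ρ ∈ BSet := by
  obtain ⟨hx, hr, hf, -⟩ := h
  have hCv : (C v : MvPolynomial (Fin 3) k) ≠ 0 := by simpa using hv
  simp only [map_zero, mul_zero, zero_mul, sub_zero, add_zero, ne_eq, OfNat.ofNat_ne_zero,
    not_false_eq_true, zero_pow] at hx hr
  have hx₂ : ρ (X 1) = C v ^ 2 * X 1 := by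
    refine mul_left_cancel₀ (mul_ne_zero (pow_ne_zero 4 hCv) fP_ne_zero) ?_
    have e : ρ rP = ρ (X 1) * ρ fP + ρ (X 0) ^ 2 := by simp only [rP, map_add, map_mul, map_pow]
    rw [hr, hf, hx] at e
    simp only [rP] at e
    linear_combination -e
  have hx₃ : ρ (X 2) = C v * X 2 := by
    refine mul_left_cancel₀ (mul_ne_zero (pow_ne_zero 3 hCv) (X_ne_zero (0 : Fin 3))) ?_
    have e : ρ fP = ρ (X 0) * ρ (X 2) - ρ (X 1) ^ 2 := by simp only [fP, map_sub, map_mul, map_pow]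
    rw [hf, hx, hx₂] at e
    simp only [fP] at e
    linear_combination -e
  exact ⟨v, hv, by simpa using hx, by simpa using hx₂, hx₃⟩

lemma IsBeta.isExpBeta {u : k} {β : MvPolynomial (Fin 3) k ≃ₐ[k] MvPolynomial (Fin 3) k}
    (h : IsBeta u β) : IsExpBeta 0 u β := by
  obtain ⟨h₁, h₂, h₃⟩ := h
  refine ⟨?_, ?_, ?_, ?_⟩
  all_goals
    simp only [rP, gP, fP, map_mul, map_add, map_sub, map_pow, map_ofNat, h₁, h₂, h₃, map_zero]
    ring

lemma IsBeta.isAffine {u : k} (hu : u ≠ 0)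
    {β : MvPolynomial (Fin 3) k ≃ₐ[k] MvPolynomial (Fin 3) k} (h : IsBeta u β) : IsAffine β := by
  obtain ⟨h₁, h₂, h₃⟩ := h
  refine ⟨Matrix.diagonal ![u ^ 3, u ^ 2, u], 0, ?_, fun i => ?_⟩
  · simp [Matrix.det_diagonal, Fin.prod_univ_three, hu]
  · fin_cases i <;> simp [Fin.sum_univ_three, Matrix.diagonal, h₁, h₂, h₃]

lemma BSet_subset_AffSet : (BSet : Set (MvPolynomial (Fin 3) k ≃ₐ[k] _)) ⊆ AffSet :=
  fun _ ⟨_, hu, h⟩ => h.isAffine hu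

lemma Del_apply (h : MvPolynomial (Fin 3) k) : Del h =
    (pderiv 1 fP * pderiv 2 gP - pderiv 2 fP * pderiv 1 gP) * pderiv 0 h +
    (pderiv 2 fP * pderiv 0 gP - pderiv 0 fP * pderiv 2 gP) * pderiv 1 h +
    (pderiv 0 fP * pderiv 1 gP - pderiv 1 fP * pderiv 0 gP) * pderiv 2 h := by
  simp only [Del, Matrix.det_fin_three, Matrix.of_apply, Matrix.cons_val', Matrix.cons_val_zero,
    Matrix.cons_val_one, Matrix.cons_val]
  ring

lemma pderiv_two (i : Fin 3) : pderiv i (2 : MvPolynomial (Fin 3) k) = 0 :=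
  mod_cast (pderiv i : Derivation k (MvPolynomial (Fin 3) k) _).map_natCast 2

lemma Del_X_zero : Del (X 0 : MvPolynomial (Fin 3) k) = -2 * rP * fP := by
  simp [Del_apply, fP, gP, rP, pderiv_X, pderiv_two]
  ring

lemma Del_rP : Del (rP : MvPolynomial (Fin 3) k) = -fP * gP := by
  simp [Del_apply, fP, gP, rP, pderiv_X, pderiv_two]
  ring

lemma Del_fP : Del (fP : MvPolynomial (Fin 3) k) = 0 := by
  rw [Del_apply]
  ring

lemma Del_gP : Del (gP : MvPolynomial (Fin 3) k) = 0 := by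
  rw [Del_apply]
  ring

lemma Del_mul (p q : MvPolynomial (Fin 3) k) : Del (p * q) = p * Del q + q * Del p := by
  simp only [Del_apply, Derivation.leibniz, smul_eq_mul]
  ring

lemma Del_C (a : k) : Del (C a : MvPolynomial (Fin 3) k) = 0 := by
  simp [Del_apply]

lemma IsExpOf.isExpBeta [CharZero k] {φ : MvPolynomial (Fin 3) k ≃ₐ[k] MvPolynomial (Fin 3) k}
    (hφ : IsExpOf Del φ) : IsExpBeta 1 1 φ := by
  have hfg : Del (-fP * gP : MvPolynomial (Fin 3) k) = 0 := by
    rw [show (-fP * gP : MvPolynomial (Fin 3) k) = C (-1) * (fP * gP) by simp, Del_mul, Del_mul,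
      Del_C, Del_fP, Del_gP]
    ring
  have hrf : Del (-2 * rP * fP : MvPolynomial (Fin 3) k) = 2 * fP ^ 2 * gP := by
    rw [show (-2 * rP * fP : MvPolynomial (Fin 3) k) = C (-2) * (rP * fP) by
      rw [map_neg, map_ofNat]; ring, Del_mul, Del_mul, Del_C, Del_fP, Del_rP, map_neg, map_ofNat]
    ring
  have hffg : Del (2 * fP ^ 2 * gP : MvPolynomial (Fin 3) k) = 0 := by
    rw [show (2 * fP ^ 2 * gP : MvPolynomial (Fin 3) k) = C 2 * (fP * (fP * gP)) by
      rw [map_ofNat]; ring, Del_mul, Del_mul, Del_mul, Del_C, Del_fP, Del_gP]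
    ring
  have hx := hφ (X 0) 3 (by simp only [Function.iterate_succ, Function.iterate_zero,
    Function.comp_apply, id_eq, Del_X_zero, hrf, hffg])
  have hr := hφ rP 2 (by simp only [Function.iterate_succ, Function.iterate_zero,
    Function.comp_apply, id_eq, Del_rP, hfg])
  have hf := hφ fP 1 (by simp [Del_fP])
  have hg := hφ gP 1 (by simp [Del_gP])
  simp only [Finset.sum_range_succ, Finset.sum_range_zero, Function.iterate_succ,
    Function.iterate_zero, Function.comp_apply, id_eq, Del_X_zero, hrf, Del_rP, zero_add,
    Nat.factorial_zero, Nat.factorial_one, Nat.factorial_two, Nat.cast_one, inv_one, one_smul,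
    Nat.cast_ofNat] at hx hr hf hg
  have h2 : (2 : k)⁻¹ • (2 * fP ^ 2 * gP : MvPolynomial (Fin 3) k) = fP ^ 2 * gP := by
    rw [smul_eq_C_mul, ← map_ofNat (C : k →+* MvPolynomial (Fin 3) k) 2, ← mul_assoc, ← mul_assoc,
      ← C_mul, inv_mul_cancel₀ two_ne_zero, C_1, one_mul]
  rw [h2] at hx
  refine ⟨?_, ?_, ?_, ?_⟩
  · rw [hx, C_1]
    ring
  · rw [hr, C_1]
    ring
  · rw [hf, C_1]
    ring
  · rw [hg, C_1]
    ring

lemma exists_isExpBeta [CharZero k] {φ ρ : MvPolynomial (Fin 3) k ≃ₐ[k] MvPolynomial (Fin 3) k}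
    (hφ : IsExpOf Del φ) (hρ : ρ ∈ Subgroup.closure ({φ} ∪ BSet)) :
    ∃ u v : k, v ≠ 0 ∧ IsExpBeta u v ρ := by
  induction hρ using Subgroup.closure_induction with
  | mem x hx =>
    rcases hx with rfl | ⟨v, hv, hx⟩
    · exact ⟨1, 1, one_ne_zero, hφ.isExpBeta⟩
    · exact ⟨0, v, hv, hx.isExpBeta⟩
  | one => exact ⟨0, 1, one_ne_zero, by simp [IsExpBeta]⟩
  | mul x y _ _ hx hy =>
    obtain ⟨u, v, hv, hx⟩ := hx
    obtain ⟨u', v', hv', hy⟩ := hy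
    exact ⟨_, _, mul_ne_zero hv hv', hx.mul hy⟩
  | inv x _ hx =>
    obtain ⟨u, v, hv, hx⟩ := hx
    exact ⟨_, _, inv_ne_zero hv, hx.inv hv⟩

end Group

/-! ### Moving points by automorphisms -/

section Points

/-- The point `e` of affine space over `k[T]` is expanding. -/
def IsExpandingPt (e : MvPolynomial (Fin 3) k →ₐ[k] Polynomial k) : Prop :=
  Expanding (e (X 0)) (e (X 1)) (e (X 2))

/-- The point `e` of affine space over `k[T]` is attracting. -/
def IsAttractingPt (e : MvPolynomial (Fin 3) k →ₐ[k] Polynomial k) : Prop :=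
  ∃ E D, Attracting E D (e (X 0)) (e (X 1)) (e (X 2))

lemma map_fP (e : MvPolynomial (Fin 3) k →ₐ[k] Polynomial k) :
    e fP = fVal (e (X 0)) (e (X 1)) (e (X 2)) := by
  simp only [fP, fVal, map_sub, map_mul, map_pow]

lemma map_rP (e : MvPolynomial (Fin 3) k →ₐ[k] Polynomial k) :
    e rP = rVal (e (X 0)) (e (X 1)) (e (X 2)) := by
  simp only [rP, rVal, map_fP, map_add, map_mul, map_pow]

lemma map_gP (e : MvPolynomial (Fin 3) k →ₐ[k] Polynomial k) :
    e gP = gVal (e (X 0)) (e (X 1)) (e (X 2)) := by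
  simp only [gP, gVal, map_fP, map_add, map_mul, map_pow, map_ofNat]

lemma map_C_eq (e : MvPolynomial (Fin 3) k →ₐ[k] Polynomial k) (a : k) :
    e (C a) = Polynomial.C a := e.commutes a

lemma IsExpandingPt.comp {e : MvPolynomial (Fin 3) k →ₐ[k] Polynomial k} (he : IsExpandingPt e)
    {u v : k} (hu : u ≠ 0) (hv : v ≠ 0)
    {ρ : MvPolynomial (Fin 3) k ≃ₐ[k] MvPolynomial (Fin 3) k} (h : IsExpBeta u v ρ) :
    IsAttractingPt (e.comp (ρ : MvPolynomial (Fin 3) k →ₐ[k] MvPolynomial (Fin 3) k)) := by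
  obtain ⟨hx, hr, hf, -⟩ := h
  refine Expanding.attracting he hu hv ?_ ?_ ?_
  · simp only [AlgHom.comp_apply, AlgEquiv.coe_toAlgHom, hx, map_mul, map_add, map_sub, map_pow,
      map_ofNat, map_C_eq, map_fP, map_rP, map_gP]
  · rw [← map_rP, AlgHom.comp_apply, AlgEquiv.coe_toAlgHom, hr]
    simp only [map_mul, map_sub, map_pow, map_C_eq, map_fP, map_rP, map_gP]
  · rw [← map_fP, AlgHom.comp_apply, AlgEquiv.coe_toAlgHom, hf]
    simp only [map_mul, map_pow, map_C_eq, map_fP]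

lemma IsAttractingPt.comp [CharZero k] {e : MvPolynomial (Fin 3) k →ₐ[k] Polynomial k}
    (he : IsAttractingPt e) {α : MvPolynomial (Fin 3) k ≃ₐ[k] MvPolynomial (Fin 3) k}
    (hα : IsAffine α) (hB : α ∉ BSet) :
    IsExpandingPt (e.comp (α : MvPolynomial (Fin 3) k →ₐ[k] MvPolynomial (Fin 3) k)) := by
  obtain ⟨E, D, he⟩ := he
  obtain ⟨A, b, hA, h⟩ := hα
  have hX : ∀ j, (e.comp (α : MvPolynomial (Fin 3) k →ₐ[k] MvPolynomial (Fin 3) k)) (X j) =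
      affVal (e (X 0)) (e (X 1)) (e (X 2)) (A 0 j) (A 1 j) (A 2 j) (b j) := fun j => by
    simp only [AlgHom.comp_apply, AlgEquiv.coe_toAlgHom, h, Fin.sum_univ_three, map_add, map_mul,
      map_C_eq, affVal]
    ring
  rw [IsExpandingPt, hX, hX, hX]
  have hdet := hA.ne_zero
  refine he.expanding_affVal (fun h0 => hdet ?_) ?_
  · rw [Matrix.det_fin_three]
    linear_combination h0
  · rintro ⟨ha₁, hb₁, hc₁, hd₁, ha₂, hb₂, hc₂, hd₂, ha₃, hb₃, hd₃⟩
    refine hB ⟨A 2 2, fun h0 => hdet ?_, ?_, ?_, ?_⟩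
    · rw [Matrix.det_fin_three, hc₁, hc₂, h0]
      ring
    · simp [h, Fin.sum_univ_three, ha₁, hb₁, hc₁, hd₁]
    · simp [h, Fin.sum_univ_three, ha₂, hb₂, hc₂, hd₂]
    · simp [h, Fin.sum_univ_three, ha₃, hb₃, hd₃]

/-- The starting point `(T, 0, T)`. -/
def basePt : MvPolynomial (Fin 3) k →ₐ[k] Polynomial k :=
  aeval ![Polynomial.X, 0, Polynomial.X]

lemma isExpandingPt_basePt : IsExpandingPt (basePt : MvPolynomial (Fin 3) k →ₐ[k] _) := by
  have hf : fVal (Polynomial.X : Polynomial k) 0 Polynomial.X = Polynomial.X ^ 2 := by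
    rw [fVal]
    ring
  have hr : rVal (Polynomial.X : Polynomial k) 0 Polynomial.X = Polynomial.X ^ 2 := by
    rw [rVal]
    ring
  have hg : gVal (Polynomial.X : Polynomial k) 0 Polynomial.X
      = Polynomial.X ^ 5 + Polynomial.X ^ 3 := by
    rw [gVal, hf]
    ring
  have hgd : (Polynomial.X ^ 5 + Polynomial.X ^ 3 : Polynomial k).natDegree = 5 := by
    compute_degree!
  simp only [IsExpandingPt, basePt, aeval_X, Matrix.cons_val_zero, Matrix.cons_val_one,
    Matrix.cons_val]
  constructor <;> simp [hf, hr, hg, hgd]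

lemma natDegree_affine_sum_le {p : Fin 3 → Polynomial k} (c : Fin 3 → k) (d : k)
    (h : ∀ i, (p i).natDegree ≤ 1) :
    (∑ i, Polynomial.C (c i) * p i + Polynomial.C d).natDegree ≤ 1 :=
  Polynomial.natDegree_add_le_of_degree_le
    (Polynomial.natDegree_sum_le_of_forall_le _ _ fun i _ =>
      (Polynomial.natDegree_C_mul_le _ _).trans (h i)) (by simp)

lemma natDegree_basePt_X_le (i : Fin 3) :
    (basePt (X i : MvPolynomial (Fin 3) k)).natDegree ≤ 1 := by
  fin_cases i <;> simp [basePt]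

lemma natDegree_affine_le {e : MvPolynomial (Fin 3) k →ₐ[k] Polynomial k}
    (he : ∀ i, (e (X i)).natDegree ≤ 1)
    {α : MvPolynomial (Fin 3) k ≃ₐ[k] MvPolynomial (Fin 3) k} (hα : IsAffine α) (i : Fin 3) :
    (e (α (X i))).natDegree ≤ 1 := by
  obtain ⟨A, b, -, h⟩ := hα
  rw [h, map_add, map_sum]
  simp only [map_mul, map_C_eq]
  exact natDegree_affine_sum_le _ _ he

lemma IsAffine.inv {α : MvPolynomial (Fin 3) k ≃ₐ[k] MvPolynomial (Fin 3) k} (hα : IsAffine α) :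
    IsAffine α⁻¹ := by
  obtain ⟨A, b, hA, h⟩ := hα
  have hAA : A * A⁻¹ = 1 := Matrix.mul_nonsing_inv A hA
  refine ⟨A⁻¹, fun i => -∑ j, A⁻¹ j i * b j, Matrix.isUnit_nonsing_inv_det A hA, fun i => ?_⟩
  apply α.injective
  rw [← AlgEquiv.mul_apply, mul_inv_cancel, AlgEquiv.one_apply]
  simp only [map_add, map_sum, map_mul, algEquiv_C, h, map_neg, mul_add, Finset.sum_add_distrib,
    Finset.mul_sum]
  rw [add_neg_cancel_right, Finset.sum_comm]
  have e : ∀ j, ∑ l, C (A⁻¹ l i) * (C (A j l) * X j) =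
      C ((1 : Matrix (Fin 3) (Fin 3) k) j i) * X j := fun j => by
    rw [← hAA, Matrix.mul_apply, map_sum, Finset.sum_mul]
    exact Finset.sum_congr rfl fun l _ => by rw [map_mul]; ring
  simp only [e, Matrix.one_apply]
  simp

lemma IsAttractingPt.not_natDegree_le {e : MvPolynomial (Fin 3) k →ₐ[k] Polynomial k}
    (he : IsAttractingPt e) : ¬ (e (X 0)).natDegree ≤ 1 := by
  obtain ⟨E, D, he⟩ := he
  have := he.pos
  have := he.lt
  have := he.x₁
  omega

lemma IsExpandingPt.comp_of_mem_closure [CharZero k]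
    {φ ρ : MvPolynomial (Fin 3) k ≃ₐ[k] MvPolynomial (Fin 3) k} (hφ : IsExpOf Del φ)
    (hρ : ρ ∈ Subgroup.closure ({φ} ∪ BSet)) (hB : ρ ∉ BSet)
    {e : MvPolynomial (Fin 3) k →ₐ[k] Polynomial k} (he : IsExpandingPt e) :
    IsAttractingPt (e.comp (ρ : MvPolynomial (Fin 3) k →ₐ[k] MvPolynomial (Fin 3) k)) := by
  obtain ⟨u, v, hv, h⟩ := exists_isExpBeta hφ hρ
  refine he.comp (fun hu => hB ?_) hv h
  rw [hu] at h
  exact h.mem_BSet hv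

lemma IsAttractingPt.comp_list_prod [CharZero k]
    {φ : MvPolynomial (Fin 3) k ≃ₐ[k] MvPolynomial (Fin 3) k} (hφ : IsExpOf Del φ)
    (L : List (MvPolynomial (Fin 3) k ≃ₐ[k] MvPolynomial (Fin 3) k))
    (hL : ∀ θ ∈ L, ∃ α ρ, θ = α * ρ ∧ (IsAffine α ∧ α ∉ BSet) ∧
      (ρ ∈ Subgroup.closure ({φ} ∪ BSet) ∧ ρ ∉ BSet))
    {e : MvPolynomial (Fin 3) k →ₐ[k] Polynomial k} (he : IsAttractingPt e) :
    IsAttractingPt (e.comp (L.prod : MvPolynomial (Fin 3) k →ₐ[k] MvPolynomial (Fin 3) k)) := by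
  induction L generalizing e with
  | nil => exact he
  | cons θ L ih =>
    obtain ⟨α, ρ, hθ, ⟨hα, hαB⟩, hρ, hρB⟩ := hL θ List.mem_cons_self
    have hθe := (he.comp hα hαB).comp_of_mem_closure hφ hρ hρB
    have := ih (fun θ' h' => hL θ' (List.mem_cons_of_mem _ h')) hθe
    rw [List.prod_cons, hθ]
    exact this

end Points

/-- (Corollary 2 of the paper.)  `⟨φ, Aff_3(k)⟩` is the
amalgamated free product of `Aff_3(k)` and `⟨φ, B⟩` over `B`.  In particular:
`Aff_3(k)` and `⟨φ, B⟩` generate `⟨φ, Aff_3(k)⟩`; `Aff_3(k) ∩ ⟨φ, B⟩ = B`; and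
every alternating product `α_1 ∘ ρ_1 ∘ ⋯ ∘ α_s ∘ ρ_s` with
`α_i ∈ Aff_3(k) \ B` and `ρ_i ∈ ⟨φ, B⟩ \ B` is not affine (hence not the identity). -/
theorem statement3 [CharZero k]
    (hln : ∀ h : MvPolynomial (Fin 3) k, ∃ l : ℕ, Del^[l] h = 0)
    (φ : MvPolynomial (Fin 3) k ≃ₐ[k] MvPolynomial (Fin 3) k)
    (hφ : IsExpOf Del φ) :
    (Subgroup.closure (AffSet ∪ (Subgroup.closure ({φ} ∪ BSet) : Set _))
        = Subgroup.closure ({φ} ∪ AffSet)) ∧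
    ({θ | IsAffine θ ∧ θ ∈ Subgroup.closure ({φ} ∪ BSet)} = BSet) ∧
    (∀ s : ℕ, 1 ≤ s →
      ∀ α ρ : Fin s → (MvPolynomial (Fin 3) k ≃ₐ[k] MvPolynomial (Fin 3) k),
        (∀ i, IsAffine (α i) ∧ α i ∉ BSet) →
        (∀ i, ρ i ∈ Subgroup.closure ({φ} ∪ BSet) ∧ ρ i ∉ BSet) →
        ¬ IsAffine ((List.ofFn fun i => α i * ρ i).prod)) := by
  refine ⟨le_antisymm ?_ ?_, ?_, ?_⟩
  · rw [Subgroup.closure_le]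
    refine Set.union_subset (Set.subset_union_right.trans Subgroup.subset_closure) ?_
    exact Subgroup.closure_mono (Set.union_subset_union_right _ BSet_subset_AffSet)
  · rw [Subgroup.closure_le]
    refine Set.union_subset ?_ (Set.subset_union_left.trans Subgroup.subset_closure)
    exact (Set.subset_union_left.trans Subgroup.subset_closure).trans
      (Set.subset_union_right.trans Subgroup.subset_closure)
  · ext θ
    refine ⟨fun ⟨hθ, hmem⟩ => ?_, fun hθ =>
      ⟨BSet_subset_AffSet hθ, Subgroup.subset_closure (Or.inr hθ)⟩⟩
    by_contra hB
    exact (isExpandingPt_basePt.comp_of_mem_closure hφ hmem hB).not_natDegree_le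
      (natDegree_affine_le natDegree_basePt_X_le hθ 0)
  · rintro (_ | s) hs α ρ hα hρ hθ
    · omega
    rw [List.ofFn_succ, List.prod_cons] at hθ
    set L := List.ofFn fun i : Fin s => α i.succ * ρ i.succ with hL
    have hatt := (isExpandingPt_basePt.comp_of_mem_closure hφ (hρ 0).1 (hρ 0).2).comp_list_prod hφ L
      (fun θ h => by
        obtain ⟨i, rfl⟩ := List.mem_ofFn.mp h
        exact ⟨_, _, rfl, hα _, hρ _⟩)
    refine hatt.not_natDegree_le ?_
    have e : ρ 0 * L.prod = (α 0)⁻¹ * (α 0 * ρ 0 * L.prod) := by group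
    have hp : ∀ i, (basePt.comp (((α 0)⁻¹ : MvPolynomial (Fin 3) k ≃ₐ[k] MvPolynomial (Fin 3) k) :
        MvPolynomial (Fin 3) k →ₐ[k] MvPolynomial (Fin 3) k) (X i)).natDegree ≤ 1 :=
      fun i => by
        rw [AlgHom.comp_apply, AlgEquiv.coe_toAlgHom]
        exact natDegree_affine_le natDegree_basePt_X_le (hα 0).1.inv i
    have := natDegree_affine_le hp hθ 0
    rw [AlgHom.comp_apply, AlgEquiv.coe_toAlgHom, ← AlgEquiv.mul_apply, ← mul_assoc] at this
    rw [AlgHom.comp_apply, AlgHom.comp_apply, AlgEquiv.coe_toAlgHom, AlgEquiv.coe_toAlgHom,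
      ← AlgEquiv.mul_apply, e]
    exact this

end YasudaPaper
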